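/- Let p ≥ 5 be a prime and let φ: ℙ¹ → ℙ¹ be an endomorphism of degree d ≥ 2 defined over F_p(t) with good reduction at every finite place. If P ∈ ℙ¹(F_p(t)) is periodic for φ with minimal period n, then n ≤ (p² − 1)p. -/

import Mathlib

set_option synthInstance.maxHeartbeats 1000000
noncomputable section

/-- The `v`-adic logarithmic distance between coordinate representatives of points of
`ℙ¹(K)`. -/
def logDist {K : Type} [Field K] (v : K → WithTop ℤ) (P Q : K × K) : WithTop ℤ :=
  v (P.1 * Q.2 - Q.1 * P.2) - min (v P.1) (v P.2) - min (v Q.1) (v Q.2)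

/-- Evaluation at a point of the pair of binary forms
`F(X,Y) = ∑ aᵢ Xⁱ Y^(d−i)`, `G(X,Y) = ∑ bᵢ Xⁱ Y^(d−i)` of degree `d`,
i.e. the map `φ([X:Y]) = [F(X,Y):G(X,Y)]` in homogeneous coordinates. -/
def evalPair {K : Type} [CommRing K] (d : ℕ) (a b : Fin (d+1) → K) (P : K × K) : K × K :=
  (∑ i : Fin (d+1), a i * P.1 ^ (i:ℕ) * P.2 ^ (d - (i:ℕ)),
   ∑ i : Fin (d+1), b i * P.1 ^ (i:ℕ) * P.2 ^ (d - (i:ℕ)))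

/-- The Sylvester matrix of the two binary forms of degree `d` with coefficient
vectors `a`, `b`. -/
def sylvester {K : Type} [CommRing K] (d : ℕ) (a b : Fin (d+1) → K) :
    Matrix (Fin (d+d)) (Fin (d+d)) K :=
  fun i j =>
    if _ : (i:ℕ) < d then
      if hj : (i:ℕ) ≤ (j:ℕ) ∧ (j:ℕ) ≤ (i:ℕ) + d then a ⟨(j:ℕ) - (i:ℕ), by omega⟩ else 0
    else
      if hj : (i:ℕ) - d ≤ (j:ℕ) ∧ (j:ℕ) ≤ (i:ℕ) then b ⟨(j:ℕ) - ((i:ℕ) - d), by omega⟩ else 0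

/-- The (homogeneous) resultant `Res(F,G)` of the two binary forms of degree `d`,
as the determinant of their Sylvester matrix. -/
def resultant {K : Type} [CommRing K] (d : ℕ) (a b : Fin (d+1) → K) : K :=
  (sylvester d a b).det

/-- The map `φ = [F:G]` has good reduction at the place `v`: after multiplying `F`
and `G` by a suitable nonzero scalar `u` (so as to be in `v`-reduced form: all
coefficients in the valuation ring of `v` and at least one of them a `v`-unit), the
resultant `Res(uF, uG)` is a `v`-unit. -/
def GoodReduction {K : Type} [Field K] (v : K → WithTop ℤ) (d : ℕ)
    (a b : Fin (d+1) → K) : Prop :=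
  ∃ u : K, u ≠ 0 ∧ (∀ i, 0 ≤ v (u * a i) ∧ 0 ≤ v (u * b i)) ∧
    ((∃ i, v (u * a i) = 0) ∨ (∃ i, v (u * b i) = 0)) ∧
    v (resultant d (fun i => u * a i) (fun i => u * b i)) = 0

open scoped Classical

/-- The valuation of `F_p(t)` attached to a monic irreducible polynomial `π` (a
finite place of `F_p(t)`). -/
def polyVal (p : ℕ) [Fact p.Prime] (π : Polynomial (ZMod p)) (f : RatFunc (ZMod p)) :
    WithTop ℤ :=
  if f = 0 then ⊤ else
    ((((UniqueFactorizationMonoid.normalizedFactors f.num).count π : ℤ) -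
      ((UniqueFactorizationMonoid.normalizedFactors f.denom).count π : ℤ) : ℤ) : WithTop ℤ)

theorem evalPair_map {R S : Type} [CommRing R] [CommRing S] (f : R →+* S) (d : ℕ)
    (a b : Fin (d+1) → R) (P : R × R) :
    evalPair d (fun i => f (a i)) (fun i => f (b i)) (Prod.map f f P) =
      Prod.map f f (evalPair d a b P) := by
  simp [evalPair, map_sum]

theorem evalPair_iterate_map {R S : Type} [CommRing R] [CommRing S] (f : R →+* S) (d : ℕ)
    (a b : Fin (d+1) → R) (m : ℕ) (P : R × R) :
    (evalPair d (fun i => f (a i)) (fun i => f (b i)))^[m] (Prod.map f f P) =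
      Prod.map f f ((evalPair d a b)^[m] P) := by
  have h : Function.Semiconj (Prod.map f f) (evalPair d a b)
      (evalPair d (fun i => f (a i)) (fun i => f (b i))) :=
    fun P => (evalPair_map f d a b P).symm
  exact ((h.iterate_right m) P).symm

theorem evalPair_smul {R : Type} [CommRing R] (d : ℕ) (a b : Fin (d+1) → R) (c : R)
    (P : R × R) : evalPair d a b (c • P) = c ^ d • evalPair d a b P := by
  have h : ∀ a : Fin (d+1) → R,
      ∑ i : Fin (d+1), a i * (c * P.1) ^ (i:ℕ) * (c * P.2) ^ (d - (i:ℕ)) =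
        c ^ d * ∑ i : Fin (d+1), a i * P.1 ^ (i:ℕ) * P.2 ^ (d - (i:ℕ)) := by
    intro a
    rw [Finset.mul_sum]
    refine Finset.sum_congr rfl fun i _ => ?_
    have : c ^ d = c ^ (i:ℕ) * c ^ (d - (i:ℕ)) := by
      rw [← pow_add]; congr 1; omega
    rw [this, mul_pow, mul_pow]; ring
  ext
  · exact h a
  · exact h b

theorem evalPair_iterate_smul {R : Type} [CommRing R] (d : ℕ) (a b : Fin (d+1) → R) (c : R)
    (m : ℕ) (P : R × R) :
    (evalPair d a b)^[m] (c • P) = c ^ d ^ m • (evalPair d a b)^[m] P := by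
  induction m with
  | zero => simp
  | succ m ih =>
    rw [Function.iterate_succ_apply', Function.iterate_succ_apply', ih, evalPair_smul, ← pow_mul,
      pow_succ]

/-- The determinant of two vectors of `R²`. -/
def wedge {R : Type} [CommRing R] (U V : R × R) : R := U.1 * V.2 - U.2 * V.1

theorem wedge_self {R : Type} [CommRing R] (U : R × R) : wedge U U = 0 := by
  unfold wedge; ring

theorem wedge_comm {R : Type} [CommRing R] (U V : R × R) : wedge U V = - wedge V U := by
  unfold wedge; ring

theorem wedge_map {R S : Type} [CommRing R] [CommRing S] (f : R →+* S) (U V : R × R) :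
    wedge (Prod.map f f U) (Prod.map f f V) = f (wedge U V) := by
  simp [wedge]

theorem wedge_smul {R : Type} [CommRing R] (c c' : R) (U V : R × R) :
    wedge (c • U) (c' • V) = c * c' * wedge U V := by
  simp [wedge]; ring

theorem wedge_smul_right {R : Type} [CommRing R] (c : R) (U V : R × R) :
    wedge U (c • V) = c * wedge U V := by
  simp [wedge]; ring

theorem plucker {R : Type} [CommRing R] (A B C D : R × R) :
    wedge A B * wedge C D - wedge A C * wedge B D + wedge A D * wedge B C = 0 := by
  unfold wedge; ring

theorem eq_smul_of_wedge_eq_zero {R : Type} [CommRing R] {U V : R × R}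
    (hU : IsCoprime U.1 U.2) (h : wedge U V = 0) : ∃ c : R, V = c • U := by
  obtain ⟨u, w, huw⟩ := hU
  unfold wedge at h
  refine ⟨u * V.1 + w * V.2, Prod.ext ?_ ?_⟩
  · simp only [Prod.smul_fst, smul_eq_mul]
    linear_combination (-V.1) * huw - w * h
  · simp only [Prod.smul_snd, smul_eq_mul]
    linear_combination (-V.2) * huw + u * h

theorem dvd_wedge_trans {R : Type} [CommRing R] {g : R} {U V W : R × R}
    (hV : IsCoprime V.1 V.2) (h1 : g ∣ wedge U V) (h2 : g ∣ wedge V W) : g ∣ wedge U W := by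
  obtain ⟨u, w, huw⟩ := hV
  have : wedge U W = (u * W.1 + w * W.2) * wedge U V + (u * U.1 + w * U.2) * wedge V W := by
    unfold wedge
    linear_combination (-(U.1 * W.2 - U.2 * W.1)) * huw
  rw [this]
  exact dvd_add (Dvd.dvd.mul_left h1 _) (Dvd.dvd.mul_left h2 _)

theorem wedge_dvd_wedge_evalPair {R : Type} [CommRing R] (d : ℕ) (a b : Fin (d+1) → R)
    {U V : R × R} (hU : IsCoprime U.1 U.2) :
    wedge U V ∣ wedge (evalPair d a b U) (evalPair d a b V) := by
  let q := Ideal.Quotient.mk (Ideal.span {wedge U V})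
  rw [← Ideal.mem_span_singleton, ← Ideal.Quotient.eq_zero_iff_mem]
  change q _ = 0
  have h0 : wedge (Prod.map q q U) (Prod.map q q V) = 0 := by
    rw [wedge_map, Ideal.Quotient.eq_zero_iff_mem]
    exact Ideal.mem_span_singleton_self _
  obtain ⟨c, hc⟩ := eq_smul_of_wedge_eq_zero (hU.map q) h0
  rw [← wedge_map, ← evalPair_map, ← evalPair_map, hc, evalPair_smul, wedge_smul_right,
    wedge_self, mul_zero]

theorem dvd_resultant {R : Type} [CommRing R] {d : ℕ} (hd : 0 < d) (a b : Fin (d+1) → R)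
    {A : R × R} (hA : IsCoprime A.1 A.2) {π : R} (hπ : Prime π)
    (h1 : π ∣ (evalPair d a b A).1) (h2 : π ∣ (evalPair d a b A).2) :
    π ∣ resultant d a b := by
  let w : Fin (d+d) → R := fun j => A.1 ^ (j:ℕ) * A.2 ^ (d + d - 1 - (j:ℕ))
  have key : ∀ (c : Fin (d+1) → R) (k : ℕ) (_ : k < d),
      ∑ j : Fin (d+d), (if hj : k ≤ (j:ℕ) ∧ (j:ℕ) ≤ k + d then c ⟨(j:ℕ) - k, by omega⟩ else 0)
        * w j = A.1 ^ k * A.2 ^ (d - 1 - k) *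
          ∑ i : Fin (d+1), c i * A.1 ^ (i:ℕ) * A.2 ^ (d - (i:ℕ)) := by
    intro c k hk
    rw [Finset.mul_sum]
    symm
    refine Finset.sum_of_injOn (fun i : Fin (d+1) => (⟨k + i, by omega⟩ : Fin (d+d))) ?_ ?_ ?_ ?_
    · intro i _ j _ h
      simp only [Fin.mk.injEq] at h
      ext; omega
    · intro i _; simp
    · intro j _ hj
      rw [dif_neg, zero_mul]
      rintro ⟨h1, h2⟩
      refine hj ⟨⟨(j:ℕ) - k, by omega⟩, by simp, ?_⟩
      ext; simp; omega
    · intro i _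
      have hi := i.2
      rw [dif_pos ⟨by simp, by simp; omega⟩]
      have e1 : (⟨k + (i:ℕ) - k, by omega⟩ : Fin (d+1)) = i := by ext; simp
      simp only [w, e1]
      have e2 : d + d - 1 - (k + (i:ℕ)) = (d - 1 - k) + (d - i) := by omega
      rw [e2, pow_add, pow_add]; ring
  have hv : ∀ i, π ∣ ((sylvester d a b).mulVec w) i := by
    intro i
    by_cases hi : (i:ℕ) < d
    · have := key a i hi
      have e : (sylvester d a b).mulVec w i =
          A.1 ^ (i:ℕ) * A.2 ^ (d - 1 - (i:ℕ)) * (evalPair d a b A).1 := by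
        refine Eq.trans ?_ this
        simp only [Matrix.mulVec, dotProduct, sylvester, hi, dif_pos]
      rw [e]
      exact Dvd.dvd.mul_left h1 _
    · have := key b ((i:ℕ) - d) (by omega)
      have e : (sylvester d a b).mulVec w i =
          A.1 ^ ((i:ℕ) - d) * A.2 ^ (d - 1 - ((i:ℕ) - d)) * (evalPair d a b A).2 := by
        refine Eq.trans ?_ this
        have e3 : (i:ℕ) - d + d = i := by omega
        simp only [Matrix.mulVec, dotProduct, sylvester, hi, e3]
        simp
      rw [e]
      exact Dvd.dvd.mul_left h2 _
  have hdet : ∀ j, π ∣ resultant d a b * w j := by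
    intro j
    have : resultant d a b * w j =
        ((sylvester d a b).adjugate.mulVec ((sylvester d a b).mulVec w)) j := by
      rw [Matrix.mulVec_mulVec, Matrix.adjugate_mul, Matrix.smul_mulVec, Matrix.one_mulVec]
      rfl
    rw [this, Matrix.mulVec, dotProduct]
    exact Finset.dvd_sum fun i _ => Dvd.dvd.mul_left (hv i) _
  by_contra hres
  have hw := fun j => (hπ.dvd_or_dvd (hdet j)).resolve_left hres
  have hA2 : π ∣ A.2 := hπ.dvd_of_dvd_pow (n := d + d - 1) (by simpa [w] using hw ⟨0, by omega⟩)
  have hA1 : π ∣ A.1 := hπ.dvd_of_dvd_pow (n := d + d - 1)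
    (by simpa [w] using hw ⟨d + d - 1, by omega⟩)
  exact hπ.not_isUnit (hA.isUnit_of_dvd' hA1 hA2)

theorem resultant_smul {R : Type} [CommRing R] (d : ℕ) (a b : Fin (d+1) → R) (u : R) :
    resultant d (fun i => u * a i) (fun i => u * b i) = u ^ (d + d) * resultant d a b := by
  have : sylvester d (fun i => u * a i) (fun i => u * b i) = u • sylvester d a b := by
    ext i j
    simp only [sylvester, Matrix.smul_apply, smul_eq_mul]
    split_ifs <;> simp
  rw [resultant, this, Matrix.det_smul, Fintype.card_fin]; rfl

theorem resultant_map {R S : Type} [CommRing R] [CommRing S] (f : R →+* S) (d : ℕ)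
    (a b : Fin (d+1) → R) :
    resultant d (fun i => f (a i)) (fun i => f (b i)) = f (resultant d a b) := by
  have : sylvester d (fun i => f (a i)) (fun i => f (b i)) = f.mapMatrix (sylvester d a b) := by
    ext i j
    simp only [sylvester, RingHom.mapMatrix_apply, Matrix.map_apply]
    split_ifs <;> simp
  rw [resultant, this, ← RingHom.map_det]; rfl

/-- More than `p + 1` nonzero vectors of `F_p²` contain two proportional ones. -/
theorem exists_wedge_eq_zero (p : ℕ) [Fact p.Prime] (v : ℕ → ZMod p × ZMod p)
    : ∃ i j, i < j ∧ j ≤ p + 1 ∧ wedge (v i) (v j) = 0 := by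
  let g : ℕ → Option (ZMod p) := fun i => if (v i).2 = 0 then none else some ((v i).1 / (v i).2)
  have hcard : (Finset.univ : Finset (Option (ZMod p))).card < (Finset.range (p + 2)).card := by
    simp [ZMod.card]
  obtain ⟨i, hi, j, hj, hij, hg⟩ := Finset.exists_ne_map_eq_of_card_lt_of_maps_to hcard
    (f := g) (fun _ _ => Finset.mem_univ _)
  have hw : wedge (v i) (v j) = 0 := by
    simp only [g] at hg
    unfold wedge
    split_ifs at hg with h1 h2 h2
    · simp [h1, h2]
    · rw [Option.some.injEq, div_eq_div_iff h1 h2] at hg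
      linear_combination hg
  simp only [Finset.mem_range] at hi hj
  rcases lt_or_gt_of_ne hij with h | h
  · exact ⟨i, j, h, by omega, hw⟩
  · exact ⟨j, i, h, by omega, by rw [wedge_comm, hw, neg_zero]⟩

section Orbit

variable {R : Type} [CommRing R] {A : ℕ → R × R}

theorem wedge_add_mul_eq_zero (hA : ∀ i, IsCoprime (A i).1 (A i).2)
    (hdvd : ∀ i j k, wedge (A i) (A j) ∣ wedge (A (i + k)) (A (j + k)))
    {n : ℕ} (hn : wedge (A 0) (A n) = 0) (i k : ℕ) : wedge (A i) (A (i + n * k)) = 0 := by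
  rw [← zero_dvd_iff]
  induction k with
  | zero => simp [wedge_self]
  | succ k ih =>
    refine dvd_wedge_trans (hA _) ih ?_
    have := hdvd 0 n (i + n * k)
    rw [hn, zero_add] at this
    rwa [show i + n * (k + 1) = n + (i + n * k) by ring]

theorem wedge_dvd_wedge_of_add (hA : ∀ i, IsCoprime (A i).1 (A i).2)
    (hdvd : ∀ i j k, wedge (A i) (A j) ∣ wedge (A (i + k)) (A (j + k)))
    {n : ℕ} (hn0 : 0 < n) (hn : wedge (A 0) (A n) = 0) (i j k : ℕ) :
    wedge (A (i + k)) (A (j + k)) ∣ wedge (A i) (A j) := by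
  obtain ⟨n, rfl⟩ : ∃ n', n = n' + 1 := ⟨n - 1, by omega⟩
  have h := hdvd (i + k) (j + k) (n * k)
  rw [show i + k + n * k = i + (n + 1) * k by ring,
    show j + k + n * k = j + (n + 1) * k by ring] at h
  have h1 := wedge_add_mul_eq_zero hA hdvd hn i k
  have h2 := wedge_add_mul_eq_zero hA hdvd hn j k
  refine dvd_wedge_trans (hA _) (h1 ▸ dvd_zero _) (dvd_wedge_trans (hA _) h ?_)
  rw [wedge_comm _ (A j), h2, neg_zero]
  exact dvd_zero _

theorem wedge_zero_dvd_wedge_zero_mul (hA : ∀ i, IsCoprime (A i).1 (A i).2)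
    (hdvd : ∀ i j k, wedge (A i) (A j) ∣ wedge (A (i + k)) (A (j + k))) (k l : ℕ) :
    wedge (A 0) (A k) ∣ wedge (A 0) (A (k * l)) := by
  induction l with
  | zero => simp [wedge_self]
  | succ l ih =>
    refine dvd_wedge_trans (hA _) ih ?_
    have := hdvd 0 k (k * l)
    rwa [zero_add, add_comm, ← Nat.mul_succ] at this

end Orbit

open Polynomial in
/-- An orbit of `p`-power length which is compatible with reduction at all finite places
has length at most `p`. -/
theorem wedge_prime_eq_zero {p : ℕ} [Fact p.Prime] (hp : 3 ≤ p) {A : ℕ → (ZMod p)[X] × (ZMod p)[X]}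
    (hA : ∀ i, IsCoprime (A i).1 (A i).2)
    (hdvd : ∀ i j k, wedge (A i) (A j) ∣ wedge (A (i + k)) (A (j + k)))
    {e : ℕ} (he : wedge (A 0) (A (p ^ e)) = 0) : wedge (A 0) (A p) = 0 := by
  have hpp : p.Prime := Fact.out
  by_contra hne
  have hD : wedge (A 0) (A 1) ≠ 0 := fun h => hne <| by
    have := wedge_zero_dvd_wedge_zero_mul hA hdvd 1 p
    rwa [h, one_mul, zero_dvd_iff] at this
  have he0 : e ≠ 0 := by
    rintro rfl
    exact hD (by simpa using he)
  have hT : 0 < p ^ e := pow_pos hpp.pos e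
  have assoc : ∀ {P Q : (ZMod p)[X]}, P ∣ Q → Q ∣ P → ∃ r : ZMod p, r ≠ 0 ∧ Q = P * C r := by
    intro P Q h1 h2
    obtain ⟨u, hu⟩ := associated_of_dvd_dvd h1 h2
    obtain ⟨r, hr, hr'⟩ := Polynomial.isUnit_iff.1 u.isUnit
    exact ⟨r, hr.ne_zero, by rw [hr', hu]⟩
  have shift : ∀ i k, wedge (A 0) (A k) ∣ wedge (A i) (A (k + i)) ∧
      wedge (A i) (A (k + i)) ∣ wedge (A 0) (A k) := by
    intro i k
    have h1 := hdvd 0 k i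
    have h2 := wedge_dvd_wedge_of_add hA hdvd hT he 0 k i
    rw [zero_add] at h1 h2
    exact ⟨h1, h2⟩
  have unit : ∀ i j, i < j → ¬ p ∣ j - i →
      ∃ r : ZMod p, r ≠ 0 ∧ wedge (A i) (A j) = wedge (A 0) (A 1) * C r := by
    intro i j hij hk
    obtain ⟨k, rfl⟩ : ∃ k, j = k + i := ⟨j - i, by omega⟩
    rw [Nat.add_sub_cancel] at hk
    have hT1 : 1 < p ^ e := Nat.one_lt_pow he0 hpp.one_lt
    obtain ⟨l, hl⟩ := Nat.exists_mul_mod_eq_one_of_coprime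
      (((Nat.Prime.coprime_iff_not_dvd hpp).2 hk).symm.pow_right e) hT1
    have hkl : k * l = 1 + p ^ e * (k * l / p ^ e) := by
      have := Nat.mod_add_div (k * l) (p ^ e)
      omega
    refine assoc (Dvd.dvd.trans ?_ (shift i k).1) ((shift i k).2.trans ?_)
    · simpa using wedge_zero_dvd_wedge_zero_mul hA hdvd 1 k
    · refine dvd_wedge_trans (hA _) (wedge_zero_dvd_wedge_zero_mul hA hdvd k l) ?_
      rw [hkl, wedge_comm _ (A 1), wedge_add_mul_eq_zero hA hdvd he, neg_zero]
      exact dvd_zero _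
  have ndvd : ∀ k, 0 < k → k < p → ¬ p ∣ k := fun k h1 h2 h3 =>
    absurd (Nat.le_of_dvd h1 h3) (by omega)
  have ndvd' : ¬ p ∣ p + 1 := fun h => ndvd 1 one_pos (by omega) ((Nat.dvd_add_right dvd_rfl).1 h)
  have hp1 : ∃ r : ZMod p, wedge (A 1) (A (p + 1)) = wedge (A 0) (A 1) * C r := by
    obtain ⟨r₁, -, h₁⟩ := unit 2 (p + 1) (by omega) (ndvd _ (by omega) (by omega))
    obtain ⟨r₂, hr₂, h₂⟩ := unit 0 2 (by omega) (ndvd _ (by omega) (by omega))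
    obtain ⟨r₃, -, h₃⟩ := unit 0 (p + 1) (by omega) (by simpa using ndvd')
    obtain ⟨r₄, -, h₄⟩ := unit 1 2 (by omega) (ndvd _ (by omega) (by omega))
    have hpl := plucker (A 0) (A 1) (A 2) (A (p + 1))
    rw [h₁, h₂, h₃, h₄] at hpl
    refine ⟨r₂⁻¹ * (r₁ + r₃ * r₄), mul_left_cancel₀ hD ?_⟩
    have hC : (C r₂ : (ZMod p)[X]) * C r₂⁻¹ = 1 := by
      rw [← C_mul, mul_inv_cancel₀ hr₂, C_1]
    simp only [C_mul, C_add]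
    linear_combination (-wedge (A 0) (A 1) * wedge (A 1) (A (p + 1))) * hC - C r₂⁻¹ * hpl
  have const : ∀ i j, i ≤ j → j ≤ p + 1 →
      ∃ r : ZMod p, (i < j → r ≠ 0) ∧ wedge (A i) (A j) = wedge (A 0) (A 1) * C r := by
    intro i j hij hj
    by_cases hlt : i < j
    · by_cases hdv : p ∣ j - i
      · have hji : j = p + i := by
          have := Nat.le_of_dvd (by omega) hdv
          by_contra hcon
          have h1 : j - i = p + 1 := by omega
          exact ndvd' (h1 ▸ hdv)
        subst hji
        obtain ⟨r, hr⟩ := hp1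
        obtain ⟨s, hs, hs'⟩ := assoc ((shift 1 p).2.trans (shift i p).1)
          ((shift i p).2.trans (shift 1 p).1)
        refine ⟨r * s, fun _ h0 => hne ?_, by rw [hs', hr, C_mul, mul_assoc]⟩
        have hr0 : r = 0 := (mul_eq_zero.1 h0).resolve_right hs
        have := (shift 1 p).2
        rwa [hr, hr0, C_0, mul_zero, zero_dvd_iff] at this
      · obtain ⟨r, hr, h⟩ := unit i j hlt hdv
        exact ⟨r, fun _ => hr, h⟩
    · obtain rfl : i = j := by omega
      exact ⟨0, fun h => absurd h hlt, by simp [wedge_self]⟩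
  have const₁ : ∀ j, ∃ r : ZMod p, j ≤ p + 1 → wedge (A 1) (A j) = wedge (A 0) (A 1) * C r := by
    intro j
    by_cases hj : j ≤ p + 1
    · rcases Nat.eq_zero_or_pos j with rfl | h0
      · exact ⟨-1, fun _ => by rw [wedge_comm]; simp⟩
      · obtain ⟨r, -, h⟩ := const 1 j h0 hj
        exact ⟨r, fun _ => h⟩
    · exact ⟨0, fun h => absurd h hj⟩
  have const₀ : ∀ j, ∃ r : ZMod p, j ≤ p + 1 → wedge (A 0) (A j) = wedge (A 0) (A 1) * C r := by
    intro j
    by_cases hj : j ≤ p + 1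
    · obtain ⟨r, -, h⟩ := const 0 j (Nat.zero_le _) hj
      exact ⟨r, fun _ => h⟩
    · exact ⟨0, fun h => absurd h hj⟩
  choose r₁ hr₁ using const₁
  choose r₀ hr₀ using const₀
  obtain ⟨i, j, hij, hj, hw⟩ := exists_wedge_eq_zero p fun i => (r₀ i, r₁ i)
  obtain ⟨r, hr, h⟩ := const i j hij.le hj
  refine hr hij (C_injective (mul_left_cancel₀ (mul_ne_zero hD hD) ?_))
  have hpl := plucker (A 0) (A 1) (A i) (A j)
  rw [h, hr₀ j hj, hr₀ i (by omega), hr₁ i (by omega), hr₁ j hj] at hpl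
  have hw' := congrArg C hw
  simp only [wedge, C_sub, C_mul, C_0] at hw'
  rw [C_0, mul_zero]
  linear_combination hpl + wedge (A 0) (A 1) ^ 2 * hw'

section Local

variable {k : Type} [Field k]

open PowerSeries in
theorem constantCoeff_eval (f : Polynomial k⟦X⟧) {x : k⟦X⟧} (hx : constantCoeff x = 0) :
    constantCoeff (f.eval x) = constantCoeff (f.eval 0) := by
  have h := (map_dvd (constantCoeff (R := k)) (Polynomial.sub_dvd_eval_sub x 0 f))
  rw [sub_zero, hx, zero_dvd_iff, map_sub, sub_eq_zero] at h
  exact h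

open PowerSeries in
theorem exists_eval_mul_eval_sub (N Q : Polynomial k⟦X⟧) : ∃ c : k, ∀ x y : k⟦X⟧,
    constantCoeff x = 0 → constantCoeff y = 0 →
      ∃ h, N.eval x * Q.eval y - N.eval y * Q.eval x = (x - y) * h ∧ constantCoeff h = c := by
  refine ⟨constantCoeff ((Polynomial.derivative N * Q - Polynomial.derivative Q * N).eval 0),
    fun x y hx hy => ?_⟩
  obtain ⟨u, hu⟩ := Polynomial.binomExpansion N y (x - y)
  obtain ⟨v, hv⟩ := Polynomial.binomExpansion Q y (x - y)
  rw [add_sub_cancel] at hu hv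
  refine ⟨(Polynomial.derivative N * Q - Polynomial.derivative Q * N).eval y +
    (u * Q.eval y - v * N.eval y) * (x - y), ?_, ?_⟩
  · rw [hu, hv, Polynomial.eval_sub, Polynomial.eval_mul, Polynomial.eval_mul]
    ring
  · rw [map_add, constantCoeff_eval _ hy, map_mul, map_sub, map_sub _ x y, hx, hy]
    simp

open PowerSeries in
theorem exists_multiplier (N Q : Polynomial k⟦X⟧) (hQ : constantCoeff (Q.eval 0) ≠ 0)
    (x : ℕ → k⟦X⟧) (hx : ∀ i, constantCoeff (x i) = 0)
    (hstep : ∀ i, Q.eval (x i) * x (i + 1) = N.eval (x i)) :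
    ∃ c : k, ∀ i j, ∃ h, x (i + 1) - x (j + 1) = (x i - x j) * h ∧ constantCoeff h = c := by
  obtain ⟨c, hc⟩ := exists_eval_mul_eval_sub N Q
  refine ⟨c * (constantCoeff (Q.eval 0))⁻¹ * (constantCoeff (Q.eval 0))⁻¹, fun i j => ?_⟩
  obtain ⟨h, h1, h2⟩ := hc (x i) (x j) (hx i) (hx j)
  have hi := PowerSeries.mul_inv_cancel (Q.eval (x i)) (by rwa [constantCoeff_eval _ (hx i)])
  have hj := PowerSeries.mul_inv_cancel (Q.eval (x j)) (by rwa [constantCoeff_eval _ (hx j)])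
  refine ⟨h * (Q.eval (x i))⁻¹ * (Q.eval (x j))⁻¹, ?_, ?_⟩
  · have e : x (i + 1) = (Q.eval (x i))⁻¹ * N.eval (x i) := by
      rw [← hstep]; linear_combination (-x (i + 1)) * hi
    have e' : x (j + 1) = (Q.eval (x j))⁻¹ * N.eval (x j) := by
      rw [← hstep]; linear_combination (-x (j + 1)) * hj
    rw [e, e']
    linear_combination (Q.eval (x i))⁻¹ * (Q.eval (x j))⁻¹ * h1
      - (Q.eval (x i))⁻¹ * N.eval (x i) * hj + (Q.eval (x j))⁻¹ * N.eval (x j) * hi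
  · simp only [map_mul, constantCoeff_inv, h2, constantCoeff_eval _ (hx _)]

open PowerSeries in
/-- Periodic points congruent to each other, of period prime to the residue characteristic
and multiplier `0` or `1`, are fixed. -/
theorem eq_of_multiplier {x : ℕ → k⟦X⟧} {c : k}
    (hc : ∀ i j, ∃ h, x (i + 1) - x (j + 1) = (x i - x j) * h ∧ constantCoeff h = c)
    {q s : ℕ} (hcq : c ^ q = 0 ∨ c ^ q = 1) (hs : (s : k) ≠ 0) (hqs : x (q * s) = x 0) :
    x q = x 0 := by
  have hpow : ∀ i j l, ∃ h, x (i + l) - x (j + l) = (x i - x j) * h ∧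
      constantCoeff h = c ^ l := by
    intro i j l
    induction l with
    | zero => exact ⟨1, by simp, by simp⟩
    | succ l ih =>
      obtain ⟨h, h1, h2⟩ := ih
      obtain ⟨h', h1', h2'⟩ := hc (i + l) (j + l)
      exact ⟨h * h', by rw [← add_assoc, ← add_assoc, h1', h1, mul_assoc],
        by rw [map_mul, h2, h2', pow_succ]⟩
  have hsum : ∀ i, ∃ h, x (q * i) - x 0 = (x q - x 0) * h ∧
      constantCoeff h = ∑ j ∈ Finset.range i, (c ^ q) ^ j := by
    intro i
    induction i with
    | zero => exact ⟨0, by simp, by simp⟩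
    | succ i ih =>
      obtain ⟨h, h1, h2⟩ := ih
      obtain ⟨h', h1', h2'⟩ := hpow (q * i) 0 q
      rw [zero_add] at h1'
      refine ⟨1 + h * h', ?_, ?_⟩
      · rw [Nat.mul_succ]; linear_combination h1' + h' * h1
      · rw [map_add, map_mul, h2, h2', Finset.sum_range_succ', map_one, pow_zero, add_comm,
          Finset.sum_mul]
        simp only [pow_succ]
  obtain ⟨h, h1, h2⟩ := hsum s
  rw [hqs, sub_self] at h1
  rcases mul_eq_zero.1 h1.symm with h0 | h0
  · exact sub_eq_zero.1 h0
  · rw [h0, map_zero] at h2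
    rcases hcq with hcq | hcq
    · obtain ⟨s, rfl⟩ : ∃ s', s = s' + 1 :=
        Nat.exists_eq_succ_of_ne_zero fun h => hs (by simp [h])
      rw [hcq, Finset.sum_range_succ'] at h2
      simp at h2
    · rw [hcq] at h2
      simp only [one_pow, Finset.sum_const, Finset.card_range, nsmul_eq_mul, mul_one] at h2
      exact absurd h2.symm hs

open PowerSeries in
theorem exists_local_coordinate {d m : ℕ} (a b : Fin (d+1) → k⟦X⟧) (B : ℕ → k⟦X⟧ × k⟦X⟧)
    (hB : ∀ i, IsCoprime (B i).1 (B i).2)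
    (hw : ∀ i, constantCoeff (wedge (B 0) (B i)) = 0)
    (hstep : ∀ i, B (i + 1) = (evalPair d a b)^[m] (B i)) :
    ∃ (x : ℕ → k⟦X⟧) (c : k), (∀ i, x i = 0 ↔ wedge (B 0) (B i) = 0) ∧
      ∀ i j, ∃ h, x (i + 1) - x (j + 1) = (x i - x j) * h ∧ constantCoeff h = c := by
  obtain ⟨u, w, huw⟩ := hB 0
  let l : ℕ → k⟦X⟧ := fun i => u * (B i).1 + w * (B i).2
  have h1 : ∀ i, (B i).1 = l i * (B 0).1 - wedge (B 0) (B i) * w := by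
    intro i
    simp only [l, wedge]
    linear_combination (-(B i).1) * huw
  have h2 : ∀ i, (B i).2 = l i * (B 0).2 + wedge (B 0) (B i) * u := by
    intro i
    simp only [l, wedge]
    linear_combination (-(B i).2) * huw
  have hl : ∀ i, constantCoeff (l i) ≠ 0 := by
    intro i h0
    obtain ⟨α, β, h⟩ := hB i
    rw [h1, h2] at h
    have := congrArg constantCoeff h
    simp [h0, hw] at this
  have hl0 : ∀ i, l i ≠ 0 := fun i h => hl i (by simp [h])
  have hinv : ∀ i, l i * (l i)⁻¹ = 1 := fun i => PowerSeries.mul_inv_cancel _ (hl i)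
  let x : ℕ → k⟦X⟧ := fun i => wedge (B 0) (B i) * (l i)⁻¹
  have hlx : ∀ i, l i * x i = wedge (B 0) (B i) := by
    intro i
    simp only [x]
    linear_combination wedge (B 0) (B i) * hinv i
  let L : Polynomial k⟦X⟧ × Polynomial k⟦X⟧ :=
    (Polynomial.C (B 0).1 - Polynomial.X * Polynomial.C w,
      Polynomial.C (B 0).2 + Polynomial.X * Polynomial.C u)
  let f := (evalPair d (fun i => Polynomial.C (a i)) (fun i => Polynomial.C (b i)))^[m] L
  have hf : ∀ i, B (i + 1) = (l i) ^ d ^ m • Prod.map (Polynomial.evalRingHom (x i))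
      (Polynomial.evalRingHom (x i)) f := by
    intro i
    have hL : B i = l i • Prod.map (Polynomial.evalRingHom (x i))
        (Polynomial.evalRingHom (x i)) L := by
      ext1
      · simp only [L, Prod.map_fst, Prod.smul_fst, smul_eq_mul, Polynomial.coe_evalRingHom,
          Polynomial.eval_sub, Polynomial.eval_C, Polynomial.eval_mul, Polynomial.eval_X]
        rw [h1 i]; linear_combination w * hlx i
      · simp only [L, Prod.map_snd, Prod.smul_snd, smul_eq_mul, Polynomial.coe_evalRingHom,
          Polynomial.eval_add, Polynomial.eval_C, Polynomial.eval_mul, Polynomial.eval_X]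
        rw [h2 i]; linear_combination (-u) * hlx i
    have := evalPair_iterate_map (Polynomial.evalRingHom (x i)) d (fun i => Polynomial.C (a i))
      (fun i => Polynomial.C (b i)) m L
    simp only [Polynomial.coe_evalRingHom, Polynomial.eval_C] at this
    rw [hstep, hL, evalPair_iterate_smul]
    exact congrArg _ this
  let N := Polynomial.C (B 0).1 * f.2 - Polynomial.C (B 0).2 * f.1
  let Q := Polynomial.C u * f.1 + Polynomial.C w * f.2
  have hN : ∀ i, wedge (B 0) (B (i + 1)) = (l i) ^ d ^ m * N.eval (x i) := by
    intro i
    rw [hf i]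
    simp [wedge, N]; ring
  have hQ : ∀ i, l (i + 1) = (l i) ^ d ^ m * Q.eval (x i) := by
    intro i
    simp only [l]
    rw [hf i]
    simp [Q, l]; ring
  have hx0 : x 0 = 0 := by simp [x, wedge_self]
  obtain ⟨c, hc⟩ := exists_multiplier N Q (fun h => by
      apply hl 1
      have := hQ 0
      rw [zero_add, hx0] at this
      rw [this, map_mul, h, mul_zero]) x (fun i => by simp [x, hw]) (fun i => by
      have := hlx (i + 1)
      rw [hQ, hN, mul_assoc] at this
      exact mul_left_cancel₀ (pow_ne_zero _ (hl0 i)) this)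
  refine ⟨x, c, fun i => ?_, hc⟩
  rw [← hlx i]
  exact ⟨fun h => by rw [h, mul_zero], fun h => (mul_eq_zero.1 h).resolve_left (hl0 i)⟩

end Local

open Polynomial in
/-- The period bound for a pair of forms over `F_p[t]` preserving unimodular vectors. -/
theorem exists_period_le {p : ℕ} [Fact p.Prime] (hp : 3 ≤ p) {d : ℕ} (a b : Fin (d+1) → (ZMod p)[X])
    (hab : ∀ U : (ZMod p)[X] × (ZMod p)[X], IsCoprime U.1 U.2 →
      IsCoprime (evalPair d a b U).1 (evalPair d a b U).2)
    (U : (ZMod p)[X] × (ZMod p)[X]) (hU : IsCoprime U.1 U.2) {n : ℕ} (hn0 : 0 < n)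
    (hn : wedge U ((evalPair d a b)^[n] U) = 0) :
    ∃ M, 0 < M ∧ M ≤ (p ^ 2 - 1) * p ∧ wedge U ((evalPair d a b)^[M] U) = 0 := by
  have hpp : p.Prime := Fact.out
  let A : ℕ → (ZMod p)[X] × (ZMod p)[X] := fun i => (evalPair d a b)^[i] U
  have hA : ∀ i, IsCoprime (A i).1 (A i).2 := by
    intro i
    induction i with
    | zero => exact hU
    | succ i ih => simp only [A, Function.iterate_succ_apply']; exact hab _ ih
  have hdvd : ∀ i j k, wedge (A i) (A j) ∣ wedge (A (i + k)) (A (j + k)) := by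
    intro i j k
    induction k with
    | zero => exact dvd_rfl
    | succ k ih =>
      refine ih.trans ?_
      rw [← add_assoc, ← add_assoc]
      simp only [A, Function.iterate_succ_apply' _ (i + k), Function.iterate_succ_apply' _ (j + k)]
      exact wedge_dvd_wedge_evalPair d a b (hA (i + k))
  have hAn : wedge (A 0) (A n) = 0 := hn
  obtain ⟨m, hm0, hmp, hm⟩ : ∃ m, 0 < m ∧ m ≤ p + 1 ∧ (X : (ZMod p)[X]) ∣ wedge (A 0) (A m) := by
    obtain ⟨i, j, hij, hj, h⟩ := exists_wedge_eq_zero p fun i =>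
      Prod.map (constantCoeff (R := ZMod p)) (constantCoeff (R := ZMod p)) (A i)
    rw [wedge_map, constantCoeff_apply, ← X_dvd_iff] at h
    refine ⟨j - i, by omega, by omega, ?_⟩
    have := wedge_dvd_wedge_of_add hA hdvd hn0 hAn 0 (j - i) i
    rw [zero_add, Nat.sub_add_cancel hij.le] at this
    exact h.trans this
  obtain ⟨e, s, hs, rfl⟩ := Nat.exists_eq_pow_mul_and_not_dvd hn0.ne' p hpp.ne_one
  have hmi : ∀ i, (X : (ZMod p)[X]) ∣ wedge (A 0) (A (m * i)) := fun i =>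
    hm.trans (wedge_zero_dvd_wedge_zero_mul hA hdvd m i)
  have hloc : wedge (A 0) (A (m * ((p - 1) * p ^ e))) = 0 := by
    let ι := Polynomial.coeToPowerSeries.ringHom (R := ZMod p)
    have hι : Function.Injective ι := Polynomial.coe_injective _
    obtain ⟨x, c, hx, hc⟩ := exists_local_coordinate (m := m) (fun i => ι (a i)) (fun i => ι (b i))
      (fun i => Prod.map ι ι (A (m * i))) (fun i => (hA _).map ι)
      (fun i => by
        rw [wedge_map]
        have := X_dvd_iff.1 (hmi i)
        simpa [ι, Polynomial.coeff_coe, ← PowerSeries.coeff_zero_eq_constantCoeff_apply] using this)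
      (fun i => by
        rw [evalPair_iterate_map]
        simp only [A]
        rw [Nat.mul_succ, add_comm, Function.iterate_add_apply])
    have hx' : ∀ i, x i = 0 ↔ wedge (A 0) (A (m * i)) = 0 := by
      intro i
      rw [hx i, wedge_map, map_eq_zero_iff ι hι, mul_zero]
    have hx0 : x 0 = 0 := by rw [hx', mul_zero, wedge_self]
    rw [← hx', ← hx0]
    refine eq_of_multiplier hc (s := s) ?_ ?_ ?_
    · by_cases h0 : c = 0
      · left
        rw [h0, zero_pow]
        exact (Nat.mul_pos (by omega) (pow_pos hpp.pos e)).ne'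
      · right
        rw [pow_mul, ZMod.pow_card_sub_one_eq_one h0, one_pow]
    · rwa [Ne, ZMod.natCast_eq_zero_iff]
    · rw [hx0, hx']
      have := wedge_add_mul_eq_zero hA hdvd hAn 0 (m * (p - 1))
      rw [zero_add] at this
      rwa [show m * ((p - 1) * p ^ e * s) = p ^ e * s * (m * (p - 1)) by ring]
  have hfin : wedge (A 0) (A (m * (p - 1) * p)) = 0 := by
    refine wedge_prime_eq_zero hp (A := fun i => A (m * (p - 1) * i)) (e := e) (fun i => hA _)
      (fun i j k => ?_) ?_
    · have := hdvd (m * (p - 1) * i) (m * (p - 1) * j) (m * (p - 1) * k)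
      rwa [← mul_add, ← mul_add] at this
    · rw [mul_zero, mul_assoc]; exact hloc
  refine ⟨m * (p - 1) * p, Nat.mul_pos (Nat.mul_pos hm0 (by omega)) hpp.pos, ?_, hfin⟩
  refine Nat.mul_le_mul_right _ ?_
  have : p ^ 2 - 1 = (p + 1) * (p - 1) := by simpa using Nat.sq_sub_sq p 1
  rw [this]
  exact Nat.mul_le_mul_right _ hmp

/-- Clearing denominators and common factors. -/
theorem exists_primitive {R K : Type} [CommRing R] [IsDomain R] [IsPrincipalIdealRing R] [Field K]
    [Algebra R K] [IsFractionRing R K] {ι : Type} [Finite ι] (x : ι → K) (hx : ∃ i, x i ≠ 0) :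
    ∃ (u : K) (y : ι → R), u ≠ 0 ∧ (∀ i, algebraMap R K (y i) = u * x i) ∧
      Ideal.span (Set.range y) = ⊤ := by
  cases nonempty_fintype ι
  obtain ⟨s, hs⟩ := IsLocalization.exist_integer_multiples_of_finite (nonZeroDivisors R) x
  choose z hz using hs
  have hs0 : algebraMap R K s ≠ 0 := IsFractionRing.to_map_ne_zero_of_mem_nonZeroDivisors s.2
  obtain ⟨g, hg⟩ := (IsPrincipalIdealRing.principal (Ideal.span (Set.range z))).principal
  have hdvd : ∀ i, g ∣ z i := fun i => by
    have : z i ∈ Ideal.span (Set.range z) := Ideal.subset_span ⟨i, rfl⟩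
    rw [hg] at this
    exact Ideal.mem_span_singleton.1 this
  choose y hy using hdvd
  have hg0 : g ≠ 0 := by
    rintro rfl
    obtain ⟨i, hi⟩ := hx
    have := hz i
    rw [hy i, zero_mul, map_zero, Algebra.smul_def] at this
    exact mul_ne_zero hs0 hi this.symm
  have hg0' : algebraMap R K g ≠ 0 := by simpa using hg0
  refine ⟨(algebraMap R K g)⁻¹ * algebraMap R K s, y, mul_ne_zero (inv_ne_zero hg0') hs0,
    fun i => ?_, ?_⟩
  · have := hz i
    rw [hy i, map_mul, Algebra.smul_def] at this
    rw [mul_assoc, ← this, inv_mul_cancel_left₀ hg0']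
  · rw [Ideal.eq_top_iff_one]
    have hmem : g ∈ Ideal.span (Set.range z) := by
      rw [hg]; exact Ideal.mem_span_singleton_self g
    obtain ⟨c, hc⟩ := (Ideal.mem_span_range_iff_exists_fun).1 hmem
    refine (Ideal.mem_span_range_iff_exists_fun).2 ⟨c, mul_left_cancel₀ hg0 ?_⟩
    rw [mul_one, Finset.mul_sum]
    refine Eq.trans (Finset.sum_congr rfl fun i _ => ?_) hc
    rw [hy i]; ring

section PolyVal

variable {p : ℕ} [Fact p.Prime] (π : Polynomial (ZMod p))

theorem polyVal_mul (x y : RatFunc (ZMod p)) :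
    polyVal p π (x * y) = polyVal p π x + polyVal p π y := by
  by_cases hx : x = 0
  · simp [polyVal, hx]
  by_cases hy : y = 0
  · simp [polyVal, hy]
  have hxy := mul_ne_zero hx hy
  rw [polyVal, polyVal, polyVal, if_neg hx, if_neg hy, if_neg hxy, ← WithTop.coe_add]
  have h := congrArg (fun f => (UniqueFactorizationMonoid.normalizedFactors f).count π)
    (RatFunc.num_denom_mul x y)
  have nx := RatFunc.num_ne_zero hx
  have ny := RatFunc.num_ne_zero hy
  have nxy := RatFunc.num_ne_zero hxy
  have dx := RatFunc.denom_ne_zero x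
  have dy := RatFunc.denom_ne_zero y
  have dxy := RatFunc.denom_ne_zero (x * y)
  simp only [UniqueFactorizationMonoid.normalizedFactors_mul, nx, ny, nxy, dx, dy, dxy, ne_eq,
    mul_eq_zero, or_self, not_false_eq_true, Multiset.count_add] at h
  congr 1
  omega

theorem polyVal_zero : polyVal p π 0 = ⊤ := if_pos rfl

theorem polyVal_one : polyVal p π 1 = 0 := by
  simp [polyVal]

theorem polyVal_algebraMap {f : Polynomial (ZMod p)} (hf : f ≠ 0) :
    polyVal p π (algebraMap _ _ f) =
      (((UniqueFactorizationMonoid.normalizedFactors f).count π : ℤ) : WithTop ℤ) := by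
  rw [polyVal, if_neg (RatFunc.algebraMap_ne_zero hf)]
  simp

theorem polyVal_algebraMap_nonneg (f : Polynomial (ZMod p)) :
    0 ≤ polyVal p π (algebraMap _ _ f) := by
  by_cases hf : f = 0
  · simp [hf, polyVal_zero]
  · rw [polyVal_algebraMap π hf]
    exact_mod_cast Nat.zero_le _

variable {π}

theorem polyVal_algebraMap_eq_zero_iff (hm : π.Monic) (hi : Irreducible π)
    (f : Polynomial (ZMod p)) : polyVal p π (algebraMap _ _ f) = 0 ↔ ¬ π ∣ f := by
  by_cases hf : f = 0
  · simp [hf, polyVal_zero]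
  · rw [polyVal_algebraMap π hf, WithTop.coe_eq_zero, Nat.cast_eq_zero, Multiset.count_eq_zero,
      UniqueFactorizationMonoid.mem_normalizedFactors_iff' hf]
    simp [hi, hm.normalize_eq_self]

theorem polyVal_pow_eq_zero {x : RatFunc (ZMod p)} (hx : polyVal p π x = 0) (n : ℕ) :
    polyVal p π (x ^ n) = 0 := by
  induction n with
  | zero => rw [pow_zero, polyVal_one]
  | succ n ih => rw [pow_succ, polyVal_mul, ih, hx, add_zero]

theorem GoodReduction.not_dvd_resultant (hm : π.Monic) (hi : Irreducible π) {d : ℕ}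
    {a b : Fin (d+1) → RatFunc (ZMod p)} (h : GoodReduction (polyVal p π) d a b)
    {u : RatFunc (ZMod p)} (hu : u ≠ 0) {y z : Fin (d+1) → Polynomial (ZMod p)}
    (hy : ∀ i, algebraMap _ _ (y i) = u * a i) (hz : ∀ i, algebraMap _ _ (z i) = u * b i)
    (hyz : (∃ i, ¬ π ∣ y i) ∨ ∃ i, ¬ π ∣ z i) : ¬ π ∣ resultant d y z := by
  obtain ⟨w, hw, hnonneg, hzero, hres⟩ := h
  have ea : ∀ i, w * a i = w * u⁻¹ * algebraMap _ _ (y i) := fun i => by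
    rw [hy, ← mul_assoc, inv_mul_cancel_right₀ hu]
  have eb : ∀ i, w * b i = w * u⁻¹ * algebraMap _ _ (z i) := fun i => by
    rw [hz, ← mul_assoc, inv_mul_cancel_right₀ hu]
  simp only [ea, eb] at hnonneg hzero hres
  generalize w * u⁻¹ = t at *
  have ht : polyVal p π t = 0 := by
    refine le_antisymm ?_ ?_
    · have key : ∀ f : Polynomial (ZMod p), polyVal p π (t * algebraMap _ _ f) = 0 → polyVal p π t ≤ 0 := by
        intro f hf
        rw [polyVal_mul] at hf
        exact hf ▸ le_add_of_nonneg_right (polyVal_algebraMap_nonneg π f)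
      rcases hzero with ⟨i, h⟩ | ⟨i, h⟩ <;> exact key _ h
    · have key : ∀ f : Polynomial (ZMod p), ¬ π ∣ f → 0 ≤ polyVal p π (t * algebraMap _ _ f) → 0 ≤ polyVal p π t := by
        intro f hf h
        rwa [polyVal_mul, (polyVal_algebraMap_eq_zero_iff hm hi f).2 hf, add_zero] at h
      rcases hyz with ⟨i, h⟩ | ⟨i, h⟩
      · exact key _ h (hnonneg i).1
      · exact key _ h (hnonneg i).2
  rw [resultant_smul, resultant_map, polyVal_mul, polyVal_pow_eq_zero ht, zero_add] at hres
  exact (polyVal_algebraMap_eq_zero_iff hm hi _).1 hres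

end PolyVal

theorem evalPair_coeff_smul {R : Type} [CommRing R] (d : ℕ) (a b : Fin (d+1) → R) (u : R)
    (P : R × R) :
    evalPair d (fun i => u * a i) (fun i => u * b i) P = u • evalPair d a b P := by
  ext <;> simp [evalPair, Finset.mul_sum, mul_assoc]

theorem exists_evalPair_iterate_eq_smul {K : Type} [Field K] (d : ℕ) (a b : Fin (d+1) → K) {u : K}
    (hu : u ≠ 0) (P : K × K) (m : ℕ) : ∃ c : K, c ≠ 0 ∧
      (evalPair d (fun i => u * a i) (fun i => u * b i))^[m] P = c • (evalPair d a b)^[m] P := by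
  induction m with
  | zero => exact ⟨1, one_ne_zero, by simp⟩
  | succ m ih =>
    obtain ⟨c, hc, h⟩ := ih
    refine ⟨u * c ^ d, mul_ne_zero hu (pow_ne_zero _ hc), ?_⟩
    rw [Function.iterate_succ_apply', Function.iterate_succ_apply', h, evalPair_coeff_smul,
      evalPair_smul, smul_smul]

/-- Good reduction at all finite places gives an integral model preserving unimodular vectors. -/
theorem exists_integral_model {p : ℕ} [Fact p.Prime] {d : ℕ} (hd : 0 < d)
    (a b : Fin (d+1) → RatFunc (ZMod p))
    (hgood : ∀ π : Polynomial (ZMod p), π.Monic → Irreducible π →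
      GoodReduction (polyVal p π) d a b) :
    ∃ (u : RatFunc (ZMod p)) (y z : Fin (d+1) → Polynomial (ZMod p)), u ≠ 0 ∧
      (∀ i, algebraMap _ _ (y i) = u * a i) ∧ (∀ i, algebraMap _ _ (z i) = u * b i) ∧
      ∀ U : Polynomial (ZMod p) × Polynomial (ZMod p), IsCoprime U.1 U.2 →
        IsCoprime (evalPair d y z U).1 (evalPair d y z U).2 := by
  have hne : ∃ i, Sum.elim a b i ≠ 0 := by
    obtain ⟨w, -, -, h, -⟩ := hgood Polynomial.X Polynomial.monic_X Polynomial.irreducible_X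
    rcases h with ⟨i, h⟩ | ⟨i, h⟩
    · refine ⟨Sum.inl i, fun h0 => ?_⟩
      rw [Sum.elim_inl] at h0
      simp [h0, polyVal_zero] at h
    · refine ⟨Sum.inr i, fun h0 => ?_⟩
      rw [Sum.elim_inr] at h0
      simp [h0, polyVal_zero] at h
  obtain ⟨u, y, hu, hy, hspan⟩ := exists_primitive (R := Polynomial (ZMod p)) (Sum.elim a b) hne
  refine ⟨u, y ∘ Sum.inl, y ∘ Sum.inr, hu, fun i => hy (Sum.inl i), fun i => hy (Sum.inr i), ?_⟩
  have hmonic : ∀ π : Polynomial (ZMod p), π.Monic → Irreducible π →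
      ¬ π ∣ resultant d (y ∘ Sum.inl) (y ∘ Sum.inr) := by
    intro π hm hi
    refine (hgood π hm hi).not_dvd_resultant hm hi hu (fun i => hy (Sum.inl i))
      (fun i => hy (Sum.inr i)) ?_
    by_contra! hcon
    refine hi.not_isUnit (isUnit_of_dvd_one ?_)
    rw [← Ideal.mem_span_singleton]
    refine Ideal.span_le.2 ?_ (hspan ▸ Submodule.mem_top : (1 : Polynomial (ZMod p)) ∈ _)
    rintro _ ⟨i | i, rfl⟩
    · exact Ideal.mem_span_singleton.2 (hcon.1 i)
    · exact Ideal.mem_span_singleton.2 (hcon.2 i)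
  have hirr : ∀ π : Polynomial (ZMod p), Irreducible π →
      ¬ π ∣ resultant d (y ∘ Sum.inl) (y ∘ Sum.inr) := by
    intro π hi h
    have hass := normalize_associated π
    exact hmonic (normalize π) (Polynomial.monic_normalize hi.ne_zero)
      (hass.symm.irreducible hi) (hass.dvd_iff_dvd_left.2 h)
  intro U hU
  refine isCoprime_of_irreducible_dvd ?_ fun π hi h1 h2 =>
    hirr π hi (dvd_resultant hd _ _ hU hi.prime h1 h2)
  rintro ⟨h1, h2⟩
  exact hirr _ Polynomial.irreducible_X (dvd_resultant hd _ _ hU Polynomial.irreducible_X.prime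
    (h1 ▸ dvd_zero _) (h2 ▸ dvd_zero _))

/-- Let `p ≥ 5` be a prime and let `φ = [F:G]` be an endomorphism of `ℙ¹` of degree
`d ≥ 2` defined over `F_p(t)` with good reduction at every finite place.  If
`P ∈ ℙ¹(F_p(t))` is periodic for `φ` with minimal period `n`, then
`n ≤ (p² − 1)p`. -/
theorem minimal_period_bound_char_ge_five (p : ℕ) [Fact p.Prime] (hp : 5 ≤ p)
    (d : ℕ) (hd : 2 ≤ d)
    (a b : Fin (d+1) → RatFunc (ZMod p))
    (hgood : ∀ π : Polynomial (ZMod p), π.Monic → Irreducible π →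
      GoodReduction (polyVal p π) d a b)
    (P : RatFunc (ZMod p) × RatFunc (ZMod p)) (hP : P ≠ (0, 0))
    (n : ℕ) (hn : 0 < n)
    (hper : ∃ c : RatFunc (ZMod p), c ≠ 0 ∧ (evalPair d a b)^[n] P = c • P)
    (hmin : ∀ m : ℕ, 0 < m →
      (∃ c : RatFunc (ZMod p), c ≠ 0 ∧ (evalPair d a b)^[m] P = c • P) → n ≤ m) :
    n ≤ (p ^ 2 - 1) * p := by
  obtain ⟨u, y, z, hu, hy, hz, hyz⟩ := exists_integral_model (by omega) a b hgood
  have hne : ∃ i, ![P.1, P.2] i ≠ 0 := by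
    by_contra! h
    exact hP (Prod.ext (h 0) (h 1))
  obtain ⟨v, x, hv, hx, hspan⟩ := exists_primitive (R := Polynomial (ZMod p)) ![P.1, P.2] hne
  let ι := algebraMap (Polynomial (ZMod p)) (RatFunc (ZMod p))
  have hι : Function.Injective ι := RatFunc.algebraMap_injective (ZMod p)
  let A : Polynomial (ZMod p) × Polynomial (ZMod p) := (x 0, x 1)
  have hA : IsCoprime A.1 A.2 := by
    have h1 : (1 : Polynomial (ZMod p)) ∈ Ideal.span (Set.range x) := hspan ▸ Submodule.mem_top
    obtain ⟨c, hc⟩ := Ideal.mem_span_range_iff_exists_fun.1 h1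
    rw [Fin.sum_univ_two] at hc
    exact ⟨c 0, c 1, hc⟩
  have hAP : Prod.map ι ι A = v • P := Prod.ext (hx 0) (hx 1)
  have hiter : ∀ m, ∃ c : RatFunc (ZMod p), c ≠ 0 ∧
      Prod.map ι ι ((evalPair d y z)^[m] A) = c • (evalPair d a b)^[m] P := by
    intro m
    obtain ⟨c, hc, h⟩ := exists_evalPair_iterate_eq_smul d a b hu (v • P) m
    refine ⟨c * v ^ d ^ m, mul_ne_zero hc (pow_ne_zero _ hv), ?_⟩
    rw [← evalPair_iterate_map, hAP, mul_smul, ← evalPair_iterate_smul, ← h]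
    simp only [ι, hy, hz]
  have hcop : ∀ m, IsCoprime ((evalPair d y z)^[m] A).1 ((evalPair d y z)^[m] A).2 := by
    intro m
    induction m with
    | zero => exact hA
    | succ m ih => rw [Function.iterate_succ_apply']; exact hyz _ ih
  have hn' : wedge A ((evalPair d y z)^[n] A) = 0 := by
    obtain ⟨c, -, h⟩ := hiter n
    obtain ⟨c', -, h'⟩ := hper
    apply hι
    rw [← wedge_map, h, hAP, h', smul_smul, wedge_smul, wedge_self, mul_zero, map_zero]
  obtain ⟨M, hM0, hM, hwM⟩ := exists_period_le (by omega) y z hyz A hA hn hn'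
  refine (hmin M hM0 ?_).trans hM
  obtain ⟨c, hc⟩ := eq_smul_of_wedge_eq_zero hA hwM
  have hc0 : c ≠ 0 := by
    rintro rfl
    have := hcop M
    rw [hc, zero_smul] at this
    exact not_isCoprime_zero_zero this
  obtain ⟨c', hc', h'⟩ := hiter M
  have hcι : ι c ≠ 0 := RatFunc.algebraMap_ne_zero hc0
  refine ⟨c'⁻¹ * (ι c * v), mul_ne_zero (inv_ne_zero hc') (mul_ne_zero hcι hv), ?_⟩
  have h1 : Prod.map ι ι (c • A) = ι c • Prod.map ι ι A := by ext1 <;> simp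
  rw [hc, h1, hAP, smul_smul] at h'
  rw [mul_smul, h', smul_smul, inv_mul_cancel₀ hc', one_smul]
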